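/- arXiv:2004.06650 — 4 statements merged into one kernel-verified Lean document; each statement's English description precedes it below -/
import Mathlib

section
/- Technical game lemma, part 1 (Lemma A.1(1) of the paper): Let m ≥ 1, λ₀, λ₁ > 0, let P be a set and let F : P × (ℝ^m \ {0}) × Sym_m(ℝ) → ℝ satisfy: (F1') for each a ∈ P the map (η, X) ↦ F(a, η, X) is continuous on (ℝ^m \ {0}) × Sym_m(ℝ); (F2) |F(a, η, 0)| ≤ λ₀ for all a, η; (F3) F(a, η, X) − F(a, η, X̂) ≤ (λ₁²/2)·E⁺(X̂ − X) for all a, η, X, X̂; (F4) for all r, R > 0 there is a modulus of continuity ω_{r,R} with F(a, η̂, X) − F(a, η, X) ≤ ω_{r,R}(‖η̂ − η‖) whenever a ∈ P, ‖η̂‖, ‖η‖ ≥ r and ‖X‖ ≤ R. Let K ≥ 1 be an integer, R₀ > 0, and let η̂ ∈ ℝ^m, X̂ ∈ Sym_m(ℝ) satisfy 1/K ≤ ‖η̂‖ ≤ R₀ and ‖X̂‖ ≤ R₀. Then there exists ε₁ > 0, depending only on m, K, R₀, λ₀, λ₁, such that for every ε ∈ (0, ε₁], every η ∈ ℝ^m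 \ {0} with ‖η‖ ≤ ε^{−1/4} and every X ∈ Sym_m(ℝ) with ‖X‖ ≤ ε^{−1/2}, there exists ν̄ ∈ ℝ^m with ‖ν̄‖₁ ≤ ε^{−1/4} such that for every a ∈ P: R^ε(a, ν̄, η, X) ≥ R^ε(a, ν̄, η̂, X̂) − ε²·ω_{1/(2K), R₀}(ε^{1/4}). -/
open scoped RealInnerProductSpace

/-- Operator norm of an `m × m` real matrix, acting on Euclidean space. -/
noncomputable def opNorm {m : ℕ} (X : Matrix (Fin m) (Fin m) ℝ) : ℝ :=
  ‖(Matrix.toEuclideanCLM (𝕜 := ℝ) X : EuclideanSpace ℝ (Fin m) →L[ℝ] EuclideanSpace ℝ (Fin m))‖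

/-- The action of a matrix on a Euclidean vector. -/
noncomputable def matVec {m : ℕ} (X : Matrix (Fin m) (Fin m) ℝ)
    (v : EuclideanSpace ℝ (Fin m)) : EuclideanSpace ℝ (Fin m) :=
  Matrix.toEuclideanCLM (𝕜 := ℝ) X v

/-- `E⁺(X)`: the positive part of the largest eigenvalue of a symmetric matrix `X`. -/
noncomputable def Eplus {m : ℕ} (X : Matrix (Fin m) (Fin m) ℝ) : ℝ :=
  max 0 (sSup {r : ℝ | ∃ v : EuclideanSpace ℝ (Fin m), ‖v‖ = 1 ∧ r = ⟪matVec X v, v⟫})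

/-- The ℓ¹-norm on `ℝ^m` (the homogeneous gauge of a horizontal point). -/
noncomputable def l1Norm {m : ℕ} (v : EuclideanSpace ℝ (Fin m)) : ℝ := ∑ i, |v i|

/-- A modulus of continuity: a nondecreasing function `ω : [0,∞) → [0,∞)` with
`ω(0) = 0` and `ω(r) → 0` as `r → 0⁺`. -/
def IsModulus (ω : ℝ → ℝ) : Prop :=
  (∀ r, 0 ≤ r → 0 ≤ ω r) ∧ MonotoneOn ω (Set.Ici 0) ∧ ω 0 = 0 ∧
    Filter.Tendsto ω (nhdsWithin 0 (Set.Ioi 0)) (nhds 0)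

/-- The running cost
`R^ε(a, ν, η, X) = -ε⟨η, ν⟩ - (ε²/2)⟨Xν, ν⟩ - ε² F(a, η, X)`. -/
noncomputable def Rcost {m : ℕ} {P : Type*}
    (F : P → EuclideanSpace ℝ (Fin m) → Matrix (Fin m) (Fin m) ℝ → ℝ)
    (ε : ℝ) (a : P) (ν η : EuclideanSpace ℝ (Fin m))
    (X : Matrix (Fin m) (Fin m) ℝ) : ℝ :=
  -(ε * ⟪η, ν⟫) - ε ^ 2 / 2 * ⟪matVec X ν, ν⟫ - ε ^ 2 * F a η X

theorem matVec_sub {m : ℕ} (X Y : Matrix (Fin m) (Fin m) ℝ) (v : EuclideanSpace ℝ (Fin m)) :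
    matVec (X - Y) v = matVec X v - matVec Y v := by
  simp [matVec, map_sub]

theorem matVec_smul {m : ℕ} (X : Matrix (Fin m) (Fin m) ℝ) (c : ℝ)
    (v : EuclideanSpace ℝ (Fin m)) : matVec X (c • v) = c • matVec X v := by
  simp only [matVec, map_smul]

theorem opNorm_neg {m : ℕ} (X : Matrix (Fin m) (Fin m) ℝ) : opNorm (-X) = opNorm X := by
  simp [opNorm, map_neg]

theorem inner_matVec_le {m : ℕ} (X : Matrix (Fin m) (Fin m) ℝ) {v : EuclideanSpace ℝ (Fin m)}
    (hv : ‖v‖ ≤ 1) : ⟪matVec X v, v⟫ ≤ opNorm X := by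
  have hX : 0 ≤ opNorm X := norm_nonneg _
  calc ⟪matVec X v, v⟫ ≤ ‖matVec X v‖ * ‖v‖ := real_inner_le_norm _ _
    _ ≤ (opNorm X * ‖v‖) * ‖v‖ := by
        gcongr
        exact ContinuousLinearMap.le_opNorm _ v
    _ ≤ (opNorm X * 1) * 1 := by gcongr
    _ = opNorm X := by ring

/-- `E⁺(X)` is bounded by a value of the quadratic form of `X` on the unit ball. -/
theorem exists_Eplus_le_inner {m : ℕ} (X : Matrix (Fin m) (Fin m) ℝ) :
    ∃ v : EuclideanSpace ℝ (Fin m), ‖v‖ ≤ 1 ∧ Eplus X ≤ ⟪matVec X v, v⟫ := by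
  have hcont : Continuous fun v : EuclideanSpace ℝ (Fin m) => ⟪matVec X v, v⟫ := by
    unfold matVec
    fun_prop
  obtain ⟨v, hv, hmax⟩ := (isCompact_closedBall (0 : EuclideanSpace ℝ (Fin m)) 1).exists_isMaxOn
    ⟨0, by simp⟩ hcont.continuousOn
  have h0 : 0 ≤ ⟪matVec X v, v⟫ := by
    simpa using hmax (show (0 : EuclideanSpace ℝ (Fin m)) ∈ Metric.closedBall 0 1 by simp)
  refine ⟨v, by simpa using hv, max_le h0 (Real.sSup_le ?_ h0)⟩
  rintro _ ⟨w, hw, rfl⟩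
  exact hmax (show w ∈ Metric.closedBall 0 1 by simp [hw])

theorem Eplus_le_opNorm {m : ℕ} (X : Matrix (Fin m) (Fin m) ℝ) : Eplus X ≤ opNorm X := by
  obtain ⟨v, hv, h⟩ := exists_Eplus_le_inner X
  exact h.trans (inner_matVec_le X hv)

/-- As `exists_Eplus_le_inner`, with the sign of the vector chosen relative to `p`. -/
theorem exists_Eplus_le_inner_of_inner_nonpos {m : ℕ} (X : Matrix (Fin m) (Fin m) ℝ)
    (p : EuclideanSpace ℝ (Fin m)) :
    ∃ v : EuclideanSpace ℝ (Fin m), ‖v‖ ≤ 1 ∧ ⟪p, v⟫ ≤ 0 ∧ Eplus X ≤ ⟪matVec X v, v⟫ := by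
  obtain ⟨v, hv, h⟩ := exists_Eplus_le_inner X
  rcases le_total ⟪p, v⟫ 0 with hp | hp
  · exact ⟨v, hv, hp, h⟩
  · refine ⟨-v, by simpa using hv, by simpa using hp, ?_⟩
    simpa [matVec] using h

theorem l1Norm_le {m : ℕ} (v : EuclideanSpace ℝ (Fin m)) : l1Norm v ≤ m * ‖v‖ := by
  calc l1Norm v ≤ ∑ _i : Fin m, ‖v‖ := Finset.sum_le_sum fun i _ => PiLp.norm_apply_le v i
    _ = m * ‖v‖ := by simp

theorem Rcost_sub_Rcost {m : ℕ} {P : Type*}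
    (F : P → EuclideanSpace ℝ (Fin m) → Matrix (Fin m) (Fin m) ℝ → ℝ)
    (ε : ℝ) (a : P) (ν η ηh : EuclideanSpace ℝ (Fin m)) (X Xh : Matrix (Fin m) (Fin m) ℝ) :
    Rcost F ε a ν η X - Rcost F ε a ν ηh Xh =
      -(ε * ⟪η - ηh, ν⟫) + ε ^ 2 / 2 * ⟪matVec (Xh - X) ν, ν⟫ - ε ^ 2 * (F a η X - F a ηh Xh) := by
  simp only [Rcost, matVec_sub, inner_sub_left]
  ring

theorem abs_le_of_ellipticity {m : ℕ} {f : Matrix (Fin m) (Fin m) ℝ → ℝ} {lam0 lam1 : ℝ}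
    (h0 : |f 0| ≤ lam0)
    (hf : ∀ X Xh : Matrix (Fin m) (Fin m) ℝ, X.IsSymm → Xh.IsSymm →
      f X - f Xh ≤ lam1 ^ 2 / 2 * Eplus (Xh - X))
    {X : Matrix (Fin m) (Fin m) ℝ} (hX : X.IsSymm) :
    |f X| ≤ lam0 + lam1 ^ 2 / 2 * opNorm X := by
  have hz : (0 : Matrix (Fin m) (Fin m) ℝ).IsSymm := Matrix.isSymm_zero
  have h1 := hf X 0 hX hz
  have h2 := hf 0 X hz hX
  have h3 : lam1 ^ 2 / 2 * Eplus (0 - X) ≤ lam1 ^ 2 / 2 * opNorm X := by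
    refine mul_le_mul_of_nonneg_left ?_ (by positivity)
    rw [zero_sub, ← opNorm_neg X]
    exact Eplus_le_opNorm (-X)
  have h4 : lam1 ^ 2 / 2 * Eplus (X - 0) ≤ lam1 ^ 2 / 2 * opNorm X := by
    refine mul_le_mul_of_nonneg_left ?_ (by positivity)
    rw [sub_zero]
    exact Eplus_le_opNorm X
  rw [abs_le] at h0 ⊢
  constructor <;> linarith [h0.1, h0.2]

/-- Technical game lemma, part 1 (Lemma A.1(1)): under (F1)–(F4), for `η̂` with
`1/K ≤ ‖η̂‖ ≤ R₀` and `‖X̂‖ ≤ R₀`, there is `ε₁ > 0` depending only on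
`m, K, R₀, λ₀, λ₁` such that for all small `ε` and admissible `(η, X)` there is a
horizontal choice `ν̄` with `‖ν̄‖₁ ≤ ε^{-1/4}` guaranteeing
`R^ε(a, ν̄, η, X) ≥ R^ε(a, ν̄, η̂, X̂) - ε² ω_{1/(2K), R₀}(ε^{1/4})`. -/
theorem game_lemma_part1 {m : ℕ} (hm : 1 ≤ m) {P : Type*}
    (lam0 lam1 : ℝ) (hlam0 : 0 < lam0) (hlam1 : 0 < lam1)
    (K : ℕ) (hK : 1 ≤ K) (R0 : ℝ) (hR0 : 0 < R0) :
    ∃ ε1 : ℝ, 0 < ε1 ∧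
      ∀ (F : P → EuclideanSpace ℝ (Fin m) → Matrix (Fin m) (Fin m) ℝ → ℝ)
        (ωf : ℝ → ℝ → ℝ → ℝ),
        (∀ a : P, ContinuousOn
          (fun q : EuclideanSpace ℝ (Fin m) × Matrix (Fin m) (Fin m) ℝ => F a q.1 q.2)
          {q | q.1 ≠ 0}) →
        (∀ (a : P) (η : EuclideanSpace ℝ (Fin m)), η ≠ 0 → |F a η 0| ≤ lam0) →
        (∀ (a : P) (η : EuclideanSpace ℝ (Fin m)), η ≠ 0 →
          ∀ X Xh : Matrix (Fin m) (Fin m) ℝ, X.IsSymm → Xh.IsSymm →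
            F a η X - F a η Xh ≤ lam1 ^ 2 / 2 * Eplus (Xh - X)) →
        (∀ r R : ℝ, 0 < r → 0 < R → IsModulus (ωf r R)) →
        (∀ r R : ℝ, 0 < r → 0 < R →
          ∀ (a : P) (η ηh : EuclideanSpace ℝ (Fin m)) (X : Matrix (Fin m) (Fin m) ℝ),
            η ≠ 0 → ηh ≠ 0 → X.IsSymm → r ≤ ‖η‖ → r ≤ ‖ηh‖ → opNorm X ≤ R →
            F a ηh X - F a η X ≤ ωf r R ‖ηh - η‖) →
        ∀ (ηh : EuclideanSpace ℝ (Fin m)) (Xh : Matrix (Fin m) (Fin m) ℝ), Xh.IsSymm →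
          1 / (K : ℝ) ≤ ‖ηh‖ → ‖ηh‖ ≤ R0 → opNorm Xh ≤ R0 →
          ∀ ε : ℝ, 0 < ε → ε ≤ ε1 →
            ∀ η : EuclideanSpace ℝ (Fin m), η ≠ 0 → ‖η‖ ≤ ε ^ (-(1/4 : ℝ)) →
              ∀ X : Matrix (Fin m) (Fin m) ℝ, X.IsSymm → opNorm X ≤ ε ^ (-(1/2 : ℝ)) →
                ∃ ν : EuclideanSpace ℝ (Fin m), l1Norm ν ≤ ε ^ (-(1/4 : ℝ)) ∧
                  ∀ a : P, Rcost F ε a ν η X ≥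
                    Rcost F ε a ν ηh Xh - ε ^ 2 * ωf (1 / (2 * K)) R0 (ε ^ (1/4 : ℝ)) := by
  have hK' : (1 : ℝ) ≤ K := by exact_mod_cast hK
  have hm0 : (0 : ℝ) ≤ m := Nat.cast_nonneg m
  have hml : 0 ≤ m * lam1 := by positivity
  have hl2 : 0 ≤ lam1 ^ 2 := sq_nonneg _
  set S : ℝ := 2 * K + m * lam1 + m + R0 + 1 + lam1 ^ 2 + 2 * lam0 with hS
  have hS0 : 0 < S := by positivity
  refine ⟨(1 / S) ^ 4, by positivity, ?_⟩
  intro F ωf _ hF2 hF3 hω hF4 ηh Xh hXh hηl _ hXhR ε hε hε1 η hη _ X hX hXn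
  obtain ⟨δ, hδ, rfl⟩ : ∃ δ : ℝ, 0 < δ ∧ ε = δ ^ 4 :=
    ⟨ε ^ (1 / 4 : ℝ), by positivity, by
      rw [← Real.rpow_natCast, ← Real.rpow_mul hε.le]; norm_num⟩
  have e1 : (δ ^ 4) ^ (1 / 4 : ℝ) = δ := by
    rw [← Real.rpow_natCast, ← Real.rpow_mul hδ.le]; norm_num
  have e2 : (δ ^ 4) ^ (-(1 / 4 : ℝ)) = 1 / δ := by
    rw [Real.rpow_neg (by positivity), e1, one_div]
  have e3 : (δ ^ 4) ^ (-(1 / 2 : ℝ)) = 1 / δ ^ 2 := by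
    rw [Real.rpow_neg (by positivity), one_div, ← Real.rpow_natCast, ← Real.rpow_mul hδ.le,
      ← Real.rpow_natCast]
    norm_num
  rw [e1, e2]
  rw [e3] at hXn
  have hδS : δ * S ≤ 1 := by
    rw [← le_div_iff₀ hS0]
    exact (pow_le_pow_iff_left₀ hδ.le (by positivity) (by norm_num)).1 hε1
  have hδT {T : ℝ} (hT : T ≤ S) : δ * T ≤ 1 := (mul_le_mul_of_nonneg_left hT hδ.le).trans hδS
  have hδ1 : δ ≤ 1 := by simpa using hδT (T := 1) (by linarith)
  have hηh : ηh ≠ 0 := by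
    rw [← norm_pos_iff]
    exact lt_of_lt_of_le (by positivity) hηl
  have hr : (0 : ℝ) < 1 / (2 * K) := by positivity
  obtain ⟨hω0, hωmono, -, -⟩ := hω _ _ hr hR0
  rcases le_or_gt ‖η - ηh‖ δ with hp | hp
  · obtain ⟨v, hv, hpv, hEv⟩ := exists_Eplus_le_inner_of_inner_nonpos (Xh - X) (η - ηh)
    refine ⟨lam1 • v, ?_, fun a => ?_⟩
    · rw [le_div_iff₀ hδ]
      calc l1Norm (lam1 • v) * δ ≤ (m * ‖lam1 • v‖) * δ := by gcongr; exact l1Norm_le _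
        _ = (m * (lam1 * ‖v‖)) * δ := by rw [norm_smul, Real.norm_of_nonneg hlam1.le]
        _ ≤ (m * (lam1 * 1)) * δ := by gcongr
        _ = δ * (m * lam1) := by ring
        _ ≤ 1 := hδT (by linarith)
    · have hK2 : 1 / (K : ℝ) = 1 / (2 * K) + 1 / (2 * K) := by field_simp; norm_num
      have hδK : δ ≤ 1 / (2 * K) := by
        rw [le_div_iff₀ (by positivity)]
        exact hδT (by linarith)
      have hηr : 1 / (2 * (K : ℝ)) ≤ ‖η‖ := by
        have := norm_sub_norm_le ηh η
        rw [norm_sub_rev] at this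
        linarith
      have h3 := hF3 a η hη X Xh hX hXh
      have h4 := hF4 _ _ hr hR0 a ηh η Xh hηh hη hXh (by linarith) hηr hXhR
      have h5 : ωf (1 / (2 * K)) R0 ‖η - ηh‖ ≤ ωf (1 / (2 * K)) R0 δ :=
        hωmono (norm_nonneg _) hδ.le hp
      have key := Rcost_sub_Rcost F (δ ^ 4) a (lam1 • v) η ηh X Xh
      rw [matVec_smul, real_inner_smul_left, real_inner_smul_right, real_inner_smul_right] at key
      have h6 : δ ^ 4 * (lam1 * ⟪η - ηh, v⟫) ≤ 0 :=
        mul_nonpos_of_nonneg_of_nonpos (by positivity)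
          (mul_nonpos_of_nonneg_of_nonpos hlam1.le hpv)
      have h7 : lam1 ^ 2 / 2 * Eplus (Xh - X) ≤ lam1 ^ 2 / 2 * ⟪matVec (Xh - X) v, v⟫ := by
        gcongr
      have h8 := mul_le_mul_of_nonneg_left
        (show F a η X - F a ηh Xh ≤
          lam1 ^ 2 / 2 * ⟪matVec (Xh - X) v, v⟫ + ωf (1 / (2 * K)) R0 δ by linarith)
        (show 0 ≤ (δ ^ 4) ^ 2 by positivity)
      linarith
  · have hp0 : 0 < ‖η - ηh‖ := hδ.trans hp
    set u : EuclideanSpace ℝ (Fin m) := -(‖η - ηh‖⁻¹ • (η - ηh)) with hu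
    have hun : ‖u‖ = 1 := by
      rw [hu, norm_neg, norm_smul, norm_inv, norm_norm, inv_mul_cancel₀ hp0.ne']
    have hpu : ⟪η - ηh, u⟫ = -‖η - ηh‖ := by
      rw [hu, inner_neg_right, real_inner_smul_right, real_inner_self_eq_norm_sq]
      field_simp
    refine ⟨u, ?_, fun a => ?_⟩
    · rw [le_div_iff₀ hδ]
      calc l1Norm u * δ ≤ (m * ‖u‖) * δ := by gcongr; exact l1Norm_le _
        _ = δ * m := by rw [hun]; ring
        _ ≤ 1 := hδT (by linarith)
    · have key := Rcost_sub_Rcost F (δ ^ 4) a u η ηh X Xh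
      rw [hpu, matVec_sub, inner_sub_left] at key
      have h1 := (abs_le.1 (abs_le_of_ellipticity (hF2 a η hη) (hF3 a η hη) hX)).2
      have h2 := (abs_le.1 (abs_le_of_ellipticity (hF2 a ηh hηh) (hF3 a ηh hηh) hXh)).1
      have h3 := inner_matVec_le X hun.le
      have h4 := inner_matVec_le (-Xh) hun.le
      rw [opNorm_neg, show matVec (-Xh) u = -matVec Xh u by simp [matVec, map_neg],
        inner_neg_left] at h4
      have hXn' : δ ^ 2 * opNorm X ≤ 1 := by
        rw [le_div_iff₀ (by positivity)] at hXn
        linarith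
      have hXh' : δ ^ 2 * opNorm Xh ≤ 1 := by
        calc δ ^ 2 * opNorm Xh ≤ δ ^ 2 * R0 := by gcongr
          _ = δ * (δ * R0) := by ring
          _ ≤ 1 * 1 := by gcongr; exact hδT (by linarith)
          _ = 1 := one_mul 1
      have h5 : 0 ≤ (δ ^ 4) ^ 2 * ωf (1 / (2 * K)) R0 δ :=
        mul_nonneg (by positivity) (hω0 δ hδ.le)
      have h6 : δ ^ 4 * δ ≤ δ ^ 4 * ‖η - ηh‖ := by gcongr
      have h7 : δ * (1 + lam1 ^ 2 + 2 * lam0) ≤ 1 := hδT (by linarith)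
      have h8 : δ ^ 2 * (2 * lam0) ≤ 2 * lam0 :=
        mul_le_of_le_one_left (by positivity) (pow_le_one₀ hδ.le hδ1)
      have h9 : δ ^ 2 * ((1 + lam1 ^ 2) / 2 * (opNorm X + opNorm Xh) + 2 * lam0) ≤
          1 + lam1 ^ 2 + 2 * lam0 := by
        have := mul_le_mul_of_nonneg_left (add_le_add hXn' hXh')
          (show 0 ≤ (1 + lam1 ^ 2) / 2 by positivity)
        linarith
      have h10 : (δ ^ 4) ^ 2 * ((1 + lam1 ^ 2) / 2 * (opNorm X + opNorm Xh) + 2 * lam0) ≤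
          δ ^ 4 * δ := by
        calc _ = δ ^ 6 * (δ ^ 2 *
              ((1 + lam1 ^ 2) / 2 * (opNorm X + opNorm Xh) + 2 * lam0)) := by ring
          _ ≤ δ ^ 6 * (1 + lam1 ^ 2 + 2 * lam0) := by gcongr
          _ = δ ^ 5 * (δ * (1 + lam1 ^ 2 + 2 * lam0)) := by ring
          _ ≤ δ ^ 5 * 1 := by gcongr
          _ = δ ^ 4 * δ := by ring
      have h11 := mul_le_mul_of_nonneg_left
        (show (⟪matVec X u, u⟫ - ⟪matVec Xh u, u⟫) / 2 + (F a η X - F a ηh Xh) ≤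
          (1 + lam1 ^ 2) / 2 * (opNorm X + opNorm Xh) + 2 * lam0 by linarith)
        (show 0 ≤ (δ ^ 4) ^ 2 by positivity)
      linarith
end

section
/- The horizontal mean curvature flow operator satisfies assumption (F4) with an explicit Lipschitz modulus: for every m ≥ 1 and all r, R > 0, if η, η̂ ∈ ℝ^m satisfy ‖η‖ ≥ r and ‖η̂‖ ≥ r, and X ∈ Sym_m(ℝ) satisfies ‖X‖ ≤ R, then |F_MCF(η̂, X) − F_MCF(η, X)| ≤ (4 m R / r)·‖η̂ − η‖. -/
open scoped RealInnerProductSpace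

/-- The horizontal mean curvature flow operator
`F_MCF(η, X) = -tr[(I - η ηᵀ/‖η‖²) X]`. -/
noncomputable def FMCF {m : ℕ} (η : EuclideanSpace ℝ (Fin m))
    (X : Matrix (Fin m) (Fin m) ℝ) : ℝ :=
  -Matrix.trace ((1 - (‖η‖ ^ 2)⁻¹ • Matrix.vecMulVec (fun i => η i) (fun i => η i)) * X)

theorem FMCF_eq_neg_trace_add_inner {m : ℕ} (η : EuclideanSpace ℝ (Fin m))
    (X : Matrix (Fin m) (Fin m) ℝ) :
    FMCF η X = -X.trace +
      ⟪‖η‖⁻¹ • η, Matrix.toEuclideanCLM (𝕜 := ℝ) X (‖η‖⁻¹ • η)⟫ := by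
  have h : ⟪η, Matrix.toEuclideanCLM (𝕜 := ℝ) X η⟫ =
      (Matrix.vecMulVec (fun i => η i) (fun i => η i) * X).trace := by
    rw [EuclideanSpace.inner_eq_star_dotProduct, Matrix.ofLp_toEuclideanCLM,
      Matrix.vecMulVec_mul, Matrix.trace_vecMulVec, star_trivial, dotProduct_comm,
      Matrix.dotProduct_mulVec, dotProduct_comm]
  rw [map_smul, real_inner_smul_left, real_inner_smul_right, h, FMCF, sub_mul, one_mul,
    Matrix.trace_sub, Matrix.smul_mul, Matrix.trace_smul, smul_eq_mul]
  ring

theorem norm_inv_norm_smul_sub_le {E : Type*} [NormedAddCommGroup E] [NormedSpace ℝ E]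
    {r : ℝ} (hr : 0 < r) {x y : E} (hx : r ≤ ‖x‖) (hy : y ≠ 0) :
    ‖‖x‖⁻¹ • x - ‖y‖⁻¹ • y‖ ≤ 2 / r * ‖x - y‖ := by
  have hx0 : ‖x‖ ≠ 0 := (hr.trans_le hx).ne'
  have hy0 : ‖y‖ ≠ 0 := norm_ne_zero_iff.2 hy
  have h : ‖x‖⁻¹ • x - ‖y‖⁻¹ • y =
      ‖x‖⁻¹ • ((x - y) + (‖y‖ - ‖x‖) • (‖y‖⁻¹ • y)) := by
    match_scalars <;> field_simp
    ring
  have hu : ‖‖y‖⁻¹ • y‖ = 1 := by rw [norm_smul, norm_inv, norm_norm, inv_mul_cancel₀ hy0]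
  have hs : ‖(x - y) + (‖y‖ - ‖x‖) • (‖y‖⁻¹ • y)‖ ≤ 2 * ‖x - y‖ := by
    refine (norm_add_le _ _).trans ?_
    rw [norm_smul, hu, mul_one, Real.norm_eq_abs, abs_sub_comm]
    linarith [abs_norm_sub_norm_le x y]
  rw [h, norm_smul, norm_inv, norm_norm]
  calc ‖x‖⁻¹ * ‖(x - y) + (‖y‖ - ‖x‖) • (‖y‖⁻¹ • y)‖
      ≤ r⁻¹ * (2 * ‖x - y‖) := by gcongr
    _ = 2 / r * ‖x - y‖ := by ring

theorem abs_inner_map_self_sub_le {E : Type*} [NormedAddCommGroup E] [InnerProductSpace ℝ E]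
    (A : E →L[ℝ] E) {a b : E} (ha : ‖a‖ ≤ 1) (hb : ‖b‖ ≤ 1) :
    |⟪a, A a⟫ - ⟪b, A b⟫| ≤ 2 * ‖A‖ * ‖a - b‖ := by
  have h : ⟪a, A a⟫ - ⟪b, A b⟫ = ⟪a - b, A a⟫ + ⟪b, A (a - b)⟫ := by
    rw [map_sub, inner_sub_left, inner_sub_right]
    ring
  have h₁ : |⟪a - b, A a⟫| ≤ ‖a - b‖ * ‖A‖ :=
    (abs_real_inner_le_norm _ _).trans <| by
      gcongr
      exact A.unit_le_opNorm a ha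
  have h₂ : |⟪b, A (a - b)⟫| ≤ 1 * (‖A‖ * ‖a - b‖) :=
    (abs_real_inner_le_norm _ _).trans <| by
      gcongr
      exact A.le_opNorm _
  rw [h]
  linarith [abs_add_le ⟪a - b, A a⟫ ⟪b, A (a - b)⟫]

/-- The horizontal mean curvature flow operator satisfies (F4) with the explicit
Lipschitz modulus `ω_{r,R}(s) = (4 m R / r) s`. -/
theorem FMCF_F4 {m : ℕ} (hm : 1 ≤ m) (r R : ℝ) (hr : 0 < r) (hR : 0 < R)
    (η ηh : EuclideanSpace ℝ (Fin m)) (hη : r ≤ ‖η‖) (hηh : r ≤ ‖ηh‖)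
    (X : Matrix (Fin m) (Fin m) ℝ) (hX : X.IsSymm) (hXR : opNorm X ≤ R) :
    |FMCF ηh X - FMCF η X| ≤ 4 * (m : ℝ) * R / r * ‖ηh - η‖ := by
  have hη0 : η ≠ 0 := norm_pos_iff.1 (hr.trans_le hη)
  have hηh0 : ηh ≠ 0 := norm_pos_iff.1 (hr.trans_le hηh)
  have hm' : (1 : ℝ) ≤ m := by exact_mod_cast hm
  have unit {x : EuclideanSpace ℝ (Fin m)} (hx : x ≠ 0) : ‖‖x‖⁻¹ • x‖ ≤ 1 := by
    rw [norm_smul, norm_inv, norm_norm, inv_mul_cancel₀ (norm_ne_zero_iff.2 hx)]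
  rw [FMCF_eq_neg_trace_add_inner, FMCF_eq_neg_trace_add_inner, add_sub_add_left_eq_sub]
  calc _ ≤ 2 * opNorm X * ‖‖ηh‖⁻¹ • ηh - ‖η‖⁻¹ • η‖ :=
        abs_inner_map_self_sub_le _ (unit hηh0) (unit hη0)
    _ ≤ 2 * R * (2 / r * ‖ηh - η‖) := by
        gcongr
        exact norm_inv_norm_smul_sub_le hr hηh hη0
    _ = 4 * 1 * R / r * ‖ηh - η‖ := by ring
    _ ≤ 4 * (m : ℝ) * R / r * ‖ηh - η‖ := by gcongr
end

section
/- Spatial regularity of the game values (Lemma 4.1 of the paper, Euclidean Carnot group case): assume ψ : ℝ^N → ℝ is bounded and Lipschitz for the ℓ¹-norm with constant C_ψ (i.e. |ψ(p) − ψ(p̂)| ≤ C_ψ‖p − p̂‖₁ for all p, p̂), and that F satisfies, for constants λ₀, λ₁ > 0 and a modulus of continuity ω: (F2) |F(t, p, η, 0)| ≤ λ₀; (F3a) F(t, p, η, X) − F(t, p, η, X̂) ≤ (λ₁²/2)·E⁺(X̂ − X); and (F3b) F(t, p, η, X) − F(s, q, η, X) ≤ ω(|s − t| + ‖p − q‖₁)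 for all (t, p), (s, q) ∈ [0, T] × ℝ^N, η ∈ ℝ^N \ {0} and X ∈ Sym_N(ℝ). Then for every ε ∈ (0, 1), every t ∈ [0, T] and all p, p̂ ∈ ℝ^N: |u^ε(t, p) − u^ε(t, p̂)| ≤ C_ψ·‖p − p̂‖₁ + k_t·ε²·ω(‖p − p̂‖₁). -/
open scoped RealInnerProductSpace

/-- The value function of the two-person deterministic game with `k` steps
remaining: `gameVal μ ε ψ F k t p` is `ψ p` when `k = 0` and otherwise is
`(1 + με²)⁻¹ inf_{η,X} sup_ν [gameVal (k-1) (t - ε²) (p + εν) + R^ε(t,p,ν,η,X)]`,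
where `η` ranges over `ℝ^N \ {0}` with `‖η‖ ≤ ε^{-1/4}`, `X` over symmetric
matrices with `‖X‖ ≤ ε^{-1/2}`, `ν` over `ℝ^N` with `‖ν‖₁ ≤ ε^{-1/4}`, and
`R^ε(t,p,ν,η,X) = -ε⟨η,ν⟩ - (ε²/2)⟨Xν,ν⟩ - ε²F(t,p,η,X)`. -/
noncomputable def gameVal {N : ℕ} (μ ε : ℝ) (ψ : EuclideanSpace ℝ (Fin N) → ℝ)
    (F : ℝ → EuclideanSpace ℝ (Fin N) → EuclideanSpace ℝ (Fin N) →
      Matrix (Fin N) (Fin N) ℝ → ℝ) :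
    ℕ → ℝ → EuclideanSpace ℝ (Fin N) → ℝ
  | 0, _t, p => ψ p
  | k + 1, t, p =>
      (1 + μ * ε ^ 2)⁻¹ *
        iInf (fun ηX : {q : EuclideanSpace ℝ (Fin N) × Matrix (Fin N) (Fin N) ℝ //
            q.1 ≠ 0 ∧ ‖q.1‖ ≤ ε ^ (-(1/4 : ℝ)) ∧ q.2.IsSymm ∧ opNorm q.2 ≤ ε ^ (-(1/2 : ℝ))} =>
          iSup (fun ν : {v : EuclideanSpace ℝ (Fin N) // l1Norm v ≤ ε ^ (-(1/4 : ℝ))} =>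
            gameVal μ ε ψ F k (t - ε ^ 2) (p + ε • ν.1) +
              (-(ε * ⟪ηX.1.1, ν.1⟫) - ε ^ 2 / 2 * ⟪matVec ηX.1.2 ν.1, ν.1⟫
                - ε ^ 2 * F t p ηX.1.1 ηX.1.2)))

/-- `k_t`: the index of the time step containing `t`, i.e. the unique positive
integer with `t ∈ ((k_t - 1)ε², k_t ε²]` for `t > 0`, and `0` for `t ≤ 0`. -/
noncomputable def kIdx (ε t : ℝ) : ℕ := ⌈t / ε ^ 2⌉₊

/-- The value `u^ε(t, p)` of the deterministic game with maturity `t`. -/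
noncomputable def uVal {N : ℕ} (μ ε : ℝ) (ψ : EuclideanSpace ℝ (Fin N) → ℝ)
    (F : ℝ → EuclideanSpace ℝ (Fin N) → EuclideanSpace ℝ (Fin N) →
      Matrix (Fin N) (Fin N) ℝ → ℝ) (t : ℝ) (p : EuclideanSpace ℝ (Fin N)) : ℝ :=
  gameVal μ ε ψ F (kIdx ε t) t p

theorem l1Norm_nonneg {m : ℕ} (v : EuclideanSpace ℝ (Fin m)) : 0 ≤ l1Norm v :=
  Finset.sum_nonneg fun _ _ => abs_nonneg _

theorem l1Norm_sub_comm {m : ℕ} (v w : EuclideanSpace ℝ (Fin m)) :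
    l1Norm (v - w) = l1Norm (w - v) :=
  Finset.sum_congr rfl fun i _ => abs_sub_comm (v i) (w i)

/-- The real supremum is nonexpansive for the uniform distance. No boundedness is needed: families
at finite distance are bounded above simultaneously, and unbounded suprema are both `0`. -/
theorem Real.abs_iSup_sub_iSup_le {ι : Sort*} {f g : ι → ℝ} {c : ℝ} (hc : 0 ≤ c)
    (h : ∀ i, |f i - g i| ≤ c) : |iSup f - iSup g| ≤ c := by
  rcases isEmpty_or_nonempty ι with hι | hι
  · simpa [Real.iSup_of_isEmpty] using hc
  have le_of_bdd : ∀ {f g : ι → ℝ}, (∀ i, |f i - g i| ≤ c) → BddAbove (Set.range g) →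
      BddAbove (Set.range f) ∧ iSup f ≤ iSup g + c := by
    intro f g h hg
    have key : ∀ i, f i ≤ iSup g + c := fun i => by
      linarith [le_ciSup hg i, (abs_le.mp (h i)).2]
    exact ⟨⟨_, Set.forall_mem_range.mpr key⟩, ciSup_le key⟩
  have h' : ∀ i, |g i - f i| ≤ c := fun i => abs_sub_comm (f i) (g i) ▸ h i
  by_cases hg : BddAbove (Set.range g)
  · obtain ⟨hf, hfg⟩ := le_of_bdd h hg
    exact abs_le.mpr ⟨by linarith [(le_of_bdd h' hf).2], by linarith⟩
  · have hf : ¬BddAbove (Set.range f) := fun hf => hg (le_of_bdd h' hf).1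
    simpa [Real.iSup_of_not_bddAbove hf, Real.iSup_of_not_bddAbove hg] using hc

/-- The real infimum is nonexpansive for the uniform distance. -/
theorem Real.abs_iInf_sub_iInf_le {ι : Sort*} {f g : ι → ℝ} {c : ℝ} (hc : 0 ≤ c)
    (h : ∀ i, |f i - g i| ≤ c) : |iInf f - iInf g| ≤ c := by
  have iInf_eq : ∀ f : ι → ℝ, iInf f = -⨆ i, -f i := fun f => by
    rw [iInf, Real.sInf_def, iSup, ← Set.image_neg_eq_neg, ← Set.range_comp]
    rfl
  rw [iInf_eq, iInf_eq, neg_sub_neg]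
  refine Real.abs_iSup_sub_iSup_le hc fun i => ?_
  rw [neg_sub_neg]
  exact h i

/-- One step of the game adds at most `ε ^ 2 * d` to the oscillation of the value function, where
`d` bounds the oscillation of `F`. -/
theorem abs_gameVal_succ_sub_le {N : ℕ} {μ ε : ℝ} (hμ : 0 ≤ μ)
    {ψ : EuclideanSpace ℝ (Fin N) → ℝ}
    {F : ℝ → EuclideanSpace ℝ (Fin N) → EuclideanSpace ℝ (Fin N) →
      Matrix (Fin N) (Fin N) ℝ → ℝ}
    {k : ℕ} {t c d : ℝ} {p q : EuclideanSpace ℝ (Fin N)} (hc : 0 ≤ c) (hd : 0 ≤ d)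
    (hu : ∀ v, |gameVal μ ε ψ F k (t - ε ^ 2) (p + v) -
      gameVal μ ε ψ F k (t - ε ^ 2) (q + v)| ≤ c)
    (hF : ∀ η, η ≠ 0 → ∀ X : Matrix (Fin N) (Fin N) ℝ, X.IsSymm →
      |F t p η X - F t q η X| ≤ d) :
    |gameVal μ ε ψ F (k + 1) t p - gameVal μ ε ψ F (k + 1) t q| ≤ c + ε ^ 2 * d := by
  have hcd : 0 ≤ c + ε ^ 2 * d := by positivity
  have hdisc : 1 ≤ 1 + μ * ε ^ 2 := le_add_of_nonneg_right (by positivity)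
  simp only [gameVal]
  rw [← mul_sub, abs_mul, abs_of_nonneg (inv_nonneg.mpr (zero_le_one.trans hdisc))]
  refine (mul_le_of_le_one_left (abs_nonneg _) (inv_le_one_of_one_le₀ hdisc)).trans ?_
  refine Real.abs_iInf_sub_iInf_le hcd fun ηX => Real.abs_iSup_sub_iSup_le hcd fun ν => ?_
  have h₁ := abs_le.mp (hu (ε • ν.1))
  have h₂ := abs_le.mp (hF ηX.1.1 ηX.2.1 ηX.1.2 ηX.2.2.2.1)
  have h₃ := mul_le_mul_of_nonneg_left h₂.1 (sq_nonneg ε)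
  have h₄ := mul_le_mul_of_nonneg_left h₂.2 (sq_nonneg ε)
  exact abs_le.mpr ⟨by linarith, by linarith⟩

/-- Spatial regularity of the game values (Lemma 4.1, Euclidean Carnot group
case): if `ψ` is bounded and `C_ψ`-Lipschitz for the ℓ¹-norm and `F` satisfies
(F2), (F3a) and (F3b), then
`|u^ε(t, p) - u^ε(t, p̂)| ≤ C_ψ ‖p - p̂‖₁ + k_t ε² ω(‖p - p̂‖₁)`. -/
theorem game_value_space_regularity {N : ℕ} (hN : 1 ≤ N) (T μ : ℝ)
    (hT : 0 < T) (hμ : 0 ≤ μ)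
    (ψ : EuclideanSpace ℝ (Fin N) → ℝ)
    (F : ℝ → EuclideanSpace ℝ (Fin N) → EuclideanSpace ℝ (Fin N) →
      Matrix (Fin N) (Fin N) ℝ → ℝ)
    (Cψ lam0 lam1 : ℝ) (hlam0 : 0 < lam0) (hlam1 : 0 < lam1)
    (ω : ℝ → ℝ) (hω : IsModulus ω)
    (hψbdd : ∃ M : ℝ, ∀ q : EuclideanSpace ℝ (Fin N), |ψ q| ≤ M)
    (hψlip : ∀ p ph : EuclideanSpace ℝ (Fin N), |ψ p - ψ ph| ≤ Cψ * l1Norm (p - ph))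
    (hF2 : ∀ (t : ℝ) (p η : EuclideanSpace ℝ (Fin N)), 0 ≤ t → t ≤ T → η ≠ 0 →
      |F t p η 0| ≤ lam0)
    (hF3a : ∀ (t : ℝ) (p η : EuclideanSpace ℝ (Fin N)), 0 ≤ t → t ≤ T → η ≠ 0 →
      ∀ X Xh : Matrix (Fin N) (Fin N) ℝ, X.IsSymm → Xh.IsSymm →
        F t p η X - F t p η Xh ≤ lam1 ^ 2 / 2 * Eplus (Xh - X))
    (hF3b : ∀ (t s : ℝ) (p q η : EuclideanSpace ℝ (Fin N)),
      0 ≤ t → t ≤ T → 0 ≤ s → s ≤ T → η ≠ 0 →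
      ∀ X : Matrix (Fin N) (Fin N) ℝ, X.IsSymm →
        F t p η X - F s q η X ≤ ω (|s - t| + l1Norm (p - q))) :
    ∀ ε : ℝ, 0 < ε → ε < 1 →
      ∀ t : ℝ, 0 ≤ t → t ≤ T →
        ∀ p ph : EuclideanSpace ℝ (Fin N),
          |uVal μ ε ψ F t p - uVal μ ε ψ F t ph| ≤
            Cψ * l1Norm (p - ph) + (kIdx ε t : ℝ) * ε ^ 2 * ω (l1Norm (p - ph)) := by
  intro ε hε _ t ht htT p ph
  have hωnn : ∀ v : EuclideanSpace ℝ (Fin N), 0 ≤ ω (l1Norm v) :=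
    fun v => hω.1 _ (l1Norm_nonneg v)
  have hψnn : ∀ p ph : EuclideanSpace ℝ (Fin N), 0 ≤ Cψ * l1Norm (p - ph) :=
    fun p ph => (abs_nonneg _).trans (hψlip p ph)
  have main : ∀ (k : ℕ) (t : ℝ), (k - 1) * ε ^ 2 < t ∨ k = 0 → t ≤ T →
      ∀ p ph : EuclideanSpace ℝ (Fin N),
        |gameVal μ ε ψ F k t p - gameVal μ ε ψ F k t ph| ≤
          Cψ * l1Norm (p - ph) + k * ε ^ 2 * ω (l1Norm (p - ph)) := by
    intro k
    induction k with
    | zero =>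
      intro t _ _ p ph
      simpa [gameVal] using hψlip p ph
    | succ k ih =>
      intro t hkt htT p ph
      replace hkt : k * ε ^ 2 < t := by simpa using hkt
      have ht : 0 ≤ t := le_of_lt (lt_of_le_of_lt (by positivity) hkt)
      have hstep := abs_gameVal_succ_sub_le (F := F) (ψ := ψ) (k := k) (t := t) (p := p)
        (q := ph) (c := Cψ * l1Norm (p - ph) + k * ε ^ 2 * ω (l1Norm (p - ph))) (ε := ε) hμ
        (add_nonneg (hψnn p ph) (mul_nonneg (by positivity) (hωnn _))) (hωnn (p - ph))
        (fun v => by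
          have hv := ih (t - ε ^ 2) (Or.inl (by linarith)) (by linarith [sq_nonneg ε])
            (p + v) (ph + v)
          rwa [add_sub_add_right_eq_sub] at hv)
        (fun η hη X hX => by
          have h₁ := hF3b t t p ph η ht htT ht htT hη X hX
          have h₂ := hF3b t t ph p η ht htT ht htT hη X hX
          rw [sub_self, abs_zero, zero_add] at h₁ h₂
          rw [l1Norm_sub_comm] at h₂
          exact abs_le.mpr ⟨by linarith, h₁⟩)
      refine hstep.trans_eq ?_
      push_cast
      ring
  refine main (kIdx ε t) t ?_ htT p ph
  rcases ht.eq_or_lt with rfl | ht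
  · simp [kIdx]
  · left
    have hε2 : 0 < ε ^ 2 := by positivity
    have := Nat.ceil_lt_add_one (div_nonneg ht.le hε2.le)
    rw [← lt_div_iff₀ hε2]
    unfold kIdx
    linarith
end

section
/- Nonnegativity of the guaranteed running cost (kernel of the lower bound in the proof of Proposition 4.1 of the paper): let m ≥ 1, λ₁ > 0, let P be a set, and let F : P × (ℝ^m \ {0}) × Sym_m(ℝ) → ℝ satisfy F(a, η, 0) = 0 for all a ∈ P and η ∈ ℝ^m \ {0}, and (F3): F(a, η, X) − F(a, η, X̂) ≤ (λ₁²/2)·E⁺(X̂ − X) for all a, η, X, X̂. Then there exists ε₀ ∈ (0, 1), depending only on m and λ₁, such that for every ε ∈ (0, ε₀], every η ∈ ℝ^m \ {0} and every X ∈ Sym_m(ℝ) with ‖X‖ ≤ ε^{−1/2}, there exists ν̄ ∈ ℝ^m with ‖ν̄‖₁ ≤ ε^{−1/4} such that R^ε(a, ν̄, η, X) ≥ 0 for every a ∈ P. -/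
open scoped RealInnerProductSpace

theorem l1Norm_smul_le {m : ℕ} (c : ℝ) (v : EuclideanSpace ℝ (Fin m)) :
    l1Norm (c • v) ≤ |c| * ‖v‖ * m := by
  have h : ∀ i ∈ Finset.univ, |(c • v) i| ≤ |c| * ‖v‖ := fun i _ => by
    rw [PiLp.smul_apply, smul_eq_mul, abs_mul]
    exact mul_le_mul_of_nonneg_left (PiLp.norm_apply_le v i) (abs_nonneg c)
  simpa [l1Norm, mul_comm] using Finset.sum_le_card_nsmul Finset.univ _ _ h

theorem inner_matVec_smul {m : ℕ} (X : Matrix (Fin m) (Fin m) ℝ) (c : ℝ)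
    (v : EuclideanSpace ℝ (Fin m)) :
    ⟪matVec X (c • v), c • v⟫ = c ^ 2 * ⟪matVec X v, v⟫ := by
  simp only [matVec, map_smul, real_inner_smul_left, real_inner_smul_right]
  ring

/-- If `E⁺(X) > 0`, some unit vector realizes more than a quarter of it. -/
theorem exists_unit_quarter_Eplus_lt {m : ℕ} {X : Matrix (Fin m) (Fin m) ℝ}
    (h : 0 < Eplus X) :
    ∃ v : EuclideanSpace ℝ (Fin m), ‖v‖ = 1 ∧ Eplus X / 4 < ⟪matVec X v, v⟫ := by
  set S := {r : ℝ | ∃ v : EuclideanSpace ℝ (Fin m), ‖v‖ = 1 ∧ r = ⟪matVec X v, v⟫}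
  have hE : Eplus X = max 0 (sSup S) := rfl
  have hpos : 0 < sSup S := by
    by_contra! hle
    rw [hE, max_eq_left hle] at h
    exact lt_irrefl 0 h
  have hne : S.Nonempty := by
    by_contra hemp
    rw [Set.not_nonempty_iff_eq_empty.mp hemp, Real.sSup_empty] at hpos
    exact lt_irrefl 0 hpos
  rw [hE, max_eq_right hpos.le]
  obtain ⟨r, ⟨v, hv, rfl⟩, hr⟩ := exists_lt_of_lt_csSup hne (show sSup S / 4 < sSup S by linarith)
  exact ⟨v, hv, hr⟩

theorem le_rpow_neg_quarter {K ε : ℝ} (hK : 0 < K) (hε : 0 < ε) (h : ε ≤ K ^ (-4 : ℝ)) :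
    K ≤ ε ^ (-(1/4 : ℝ)) := by
  calc K = (K ^ (-4 : ℝ)) ^ (-(1/4 : ℝ)) := by
        rw [← Real.rpow_mul hK.le]; norm_num
    _ ≤ ε ^ (-(1/4 : ℝ)) := Real.rpow_le_rpow_of_nonpos hε h (by norm_num)

/-- Nonnegativity of the guaranteed running cost: if `F(a, η, 0) = 0` and (F3)
holds, then there is `ε₀ ∈ (0,1)`, depending only on `m` and `λ₁`, such that for
all `ε ∈ (0, ε₀]`, `η ≠ 0` and symmetric `X` with `‖X‖ ≤ ε^{-1/2}`, some `ν̄` with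
`‖ν̄‖₁ ≤ ε^{-1/4}` gives `R^ε(a, ν̄, η, X) ≥ 0` for every `a`. -/
theorem running_cost_nonneg {m : ℕ} (hm : 1 ≤ m) {P : Type*}
    (lam1 : ℝ) (hlam1 : 0 < lam1) :
    ∃ ε0 : ℝ, 0 < ε0 ∧ ε0 < 1 ∧
      ∀ F : P → EuclideanSpace ℝ (Fin m) → Matrix (Fin m) (Fin m) ℝ → ℝ,
        (∀ (a : P) (η : EuclideanSpace ℝ (Fin m)), η ≠ 0 → F a η 0 = 0) →
        (∀ (a : P) (η : EuclideanSpace ℝ (Fin m)), η ≠ 0 →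
          ∀ X Xh : Matrix (Fin m) (Fin m) ℝ, X.IsSymm → Xh.IsSymm →
            F a η X - F a η Xh ≤ lam1 ^ 2 / 2 * Eplus (Xh - X)) →
        ∀ ε : ℝ, 0 < ε → ε ≤ ε0 →
          ∀ η : EuclideanSpace ℝ (Fin m), η ≠ 0 →
            ∀ X : Matrix (Fin m) (Fin m) ℝ, X.IsSymm → opNorm X ≤ ε ^ (-(1/2 : ℝ)) →
              ∃ ν : EuclideanSpace ℝ (Fin m), l1Norm ν ≤ ε ^ (-(1/4 : ℝ)) ∧
                ∀ a : P, 0 ≤ Rcost F ε a ν η X := by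
  have hm' : (0 : ℝ) < m := by exact_mod_cast hm
  set K : ℝ := 2 * lam1 * m + 1
  have hK1 : 1 < K := by
    have : 0 < 2 * lam1 * m := by positivity
    linarith
  have hK0 : 0 < K := by linarith
  refine ⟨K ^ (-4 : ℝ), Real.rpow_pos_of_pos hK0 _,
    Real.rpow_lt_one_of_one_lt_of_neg hK1 (by norm_num), ?_⟩
  intro F hF0 hF3 ε hε hεK η hη X hX _
  have hF : ∀ a, F a η X ≤ lam1 ^ 2 / 2 * Eplus (-X) := fun a => by
    have h := hF3 a η hη X 0 hX Matrix.isSymm_zero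
    rwa [hF0 a η hη, sub_zero, zero_sub] at h
  have hbound := le_rpow_neg_quarter hK0 hε hεK
  rcases (show 0 ≤ Eplus (-X) from le_max_left _ _).eq_or_lt with hE | hE
  · refine ⟨0, ?_, fun a => ?_⟩
    · simp only [l1Norm, PiLp.zero_apply, abs_zero, Finset.sum_const_zero]
      linarith
    · have h := hF a
      rw [← hE, mul_zero] at h
      have := mul_nonneg (sq_nonneg ε) (neg_nonneg.mpr h)
      simp only [Rcost, inner_zero_right, mul_zero]
      linarith
  · obtain ⟨v, hv, hvE⟩ := exists_unit_quarter_Eplus_lt hE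
    have hneg : ⟪matVec (-X) v, v⟫ = -⟪matVec X v, v⟫ := by
      simp only [matVec, map_neg, neg_apply, inner_neg_left]
    rw [hneg] at hvE
    obtain ⟨c, hc, hcη⟩ : ∃ c : ℝ, |c| = 2 * lam1 ∧ c * ⟪η, v⟫ ≤ 0 := by
      rcases le_total ⟪η, v⟫ 0 with h | h
      · exact ⟨2 * lam1, abs_of_pos (by positivity),
          mul_nonpos_of_nonneg_of_nonpos (by positivity) h⟩
      · exact ⟨-(2 * lam1), by rw [abs_neg, abs_of_pos (by positivity)],
          mul_nonpos_of_nonpos_of_nonneg (by linarith) h⟩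
    refine ⟨c • v, ?_, fun a => ?_⟩
    · have h := l1Norm_smul_le c v
      rw [hc, hv, mul_one] at h
      linarith
    · have hc2 : c ^ 2 = 4 * lam1 ^ 2 := by rw [← sq_abs, hc]; ring
      have h1 : 0 ≤ ε * -(c * ⟪η, v⟫) := mul_nonneg hε.le (neg_nonneg.mpr hcη)
      have h2 := mul_nonneg (sq_nonneg ε) (sub_nonneg.mpr (hF a))
      have h3 := mul_nonneg (mul_nonneg (sq_nonneg ε) (sq_nonneg lam1)) (sub_nonneg.mpr hvE.le)
      rw [Rcost, inner_matVec_smul, real_inner_smul_right, hc2]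
      linarith
end
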